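/- Let M ⊂ ℝ^m be the mean-value parameter space of an m-dimensional exponential family, with M a product of open intervals, and let M' be a CINECSI subset of M. Then there exist positive constants c₁', c₂', c₃' such that for all μ' ∈ M' and all μ ∈ M (μ not restricted to M'): d_{H²}(μ',μ) ≤ c₁'‖μ'−μ‖₂² ≤ c₂'·d_ST(μ'‖μ) ≤ c₃'‖μ'−μ‖₂². -/

import Mathlib

open MeasureTheory ProbabilityTheory Real Set
open scoped ENNReal BigOperators

noncomputable section

namespace SwitchPaper

variable {𝒳 : Type*} [MeasurableSpace 𝒳]

/-- Squared Euclidean distance `‖a − b‖₂²`. -/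
def sqDist {m : ℕ} (a b : Fin m → ℝ) : ℝ := ∑ j, (a j - b j) ^ 2

/-- Euclidean inner product. -/
def dot {m : ℕ} (a b : Fin m → ℝ) : ℝ := ∑ j, a j * b j

/-- A CINECSI subset of `M`: a Connected subset of the interior of `M` that is itself
Compact and has NonEmpty interior. -/
def CINECSI {m : ℕ} (M' M : Set (Fin m → ℝ)) : Prop :=
  IsConnected M' ∧ M' ⊆ interior M ∧ IsCompact M' ∧ (interior M').Nonempty

/-- Hellinger affinity `∫ √(p q) dν = E_{p}[√(q/p)]` between two densities w.r.t. `ν`. -/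
def hellingerAffinity (ν : Measure 𝒳) (p q : 𝒳 → ℝ) : ℝ := ∫ x, Real.sqrt (p x * q x) ∂ν

/-- Squared Hellinger distance `d_{H²}(p,q) = 2(1 − E_p[√(q/p)])`. -/
def dH2 (ν : Measure 𝒳) (p q : 𝒳 → ℝ) : ℝ := 2 * (1 - hellingerAffinity ν p q)

/-- Rényi divergence of order 1/2, `d_R(p,q) = −2 log E_p[√(q/p)]`; it is symmetric. -/
def dRenyiHalf (ν : Measure 𝒳) (p q : 𝒳 → ℝ) : ℝ := -2 * Real.log (hellingerAffinity ν p q)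

/-- Kullback–Leibler divergence `D(p‖q) = ∫ p log(p/q) dν` between densities w.r.t. `ν`. -/
def klDiv' (ν : Measure 𝒳) (p q : 𝒳 → ℝ) : ℝ := ∫ x, p x * Real.log (p x / q x) ∂ν

/-- `p : M → 𝒳 → ℝ` is an `m`-dimensional exponential family w.r.t. the base measure `ν`,
given in its mean-value parameterization: the densities have the exponential form
`p_μ(x) = exp(θ(μ)ᵀ φ(x) − ψ(θ(μ))) r(x)`, each `p_μ` is a probability density w.r.t. `ν`,
the mean of the sufficient statistic `φ` under `p_μ` is `μ`, the parameter set `M` is an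
open connected product of open intervals, and the representation is minimal (the components
of `φ`, together with constants, are affinely independent). -/
structure IsMeanValueExpFam {m : ℕ} (ν : Measure 𝒳) (M : Set (Fin m → ℝ))
    (p : (Fin m → ℝ) → 𝒳 → ℝ) (θ : (Fin m → ℝ) → (Fin m → ℝ))
    (φ : 𝒳 → (Fin m → ℝ)) (ψ : (Fin m → ℝ) → ℝ) (carrier : 𝒳 → ℝ) : Prop where
  carrier_pos : ∀ x, 0 < carrier x
  φ_meas : Measurable φ
  p_meas : ∀ μ, Measurable (p μ)
  M_conn : IsConnected M
  M_prod : ∃ S : Fin m → Set ℝ, (∀ j, IsOpen (S j) ∧ (S j).OrdConnected) ∧ M = Set.univ.pi S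
  p_form : ∀ μ ∈ M, ∀ x, p μ x = Real.exp (dot (θ μ) (φ x) - ψ (θ μ)) * carrier x
  p_prob : ∀ μ ∈ M, ∫ x, p μ x ∂ν = 1
  φ_int : ∀ μ ∈ M, Integrable (fun x => (∑ j, |φ x j|) * p μ x) ν
  mean_eq : ∀ μ ∈ M, ∀ i, ∫ x, φ x i * p μ x ∂ν = μ i
  minimal : ∀ c : Fin m → ℝ, ∀ d : ℝ, (∀ x, dot c (φ x) = d) → c = 0

/-- Covariance matrix of the sufficient statistic `φ` under `p_μ`. -/
def covMatrix {m : ℕ} (ν : Measure 𝒳) (p : (Fin m → ℝ) → 𝒳 → ℝ) (φ : 𝒳 → (Fin m → ℝ))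
    (μ : Fin m → ℝ) : Matrix (Fin m) (Fin m) ℝ :=
  Matrix.of fun i j => ∫ x, (φ x i - μ i) * (φ x j - μ j) * p μ x ∂ν

/-- Fisher information matrix in the mean-value parameterization: the inverse of the
covariance matrix of the sufficient statistic. -/
def fisherInfo {m : ℕ} (ν : Measure 𝒳) (p : (Fin m → ℝ) → 𝒳 → ℝ) (φ : 𝒳 → (Fin m → ℝ))
    (μ : Fin m → ℝ) : Matrix (Fin m) (Fin m) ℝ := (covMatrix ν p φ μ)⁻¹

/-- Quadratic form `vᵀ J v`. -/
def quadForm {m : ℕ} (J : Matrix (Fin m) (Fin m) ℝ) (v : Fin m → ℝ) : ℝ :=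
  ∑ i, ∑ j, v i * J i j * v j

/-- Standardized squared error (squared Mahalanobis distance)
`d_ST(a ‖ b) = (b − a)ᵀ I(a) (b − a)`, with `I` the Fisher information. -/
def dST {m : ℕ} (ν : Measure 𝒳) (p : (Fin m → ℝ) → 𝒳 → ℝ) (φ : 𝒳 → (Fin m → ℝ))
    (a b : Fin m → ℝ) : ℝ := quadForm (fisherInfo ν p φ a) (b - a)

/-- Joint density (likelihood) of an i.i.d. sample. -/
def likelihood {m : ℕ} (p : (Fin m → ℝ) → 𝒳 → ℝ) (μ : Fin m → ℝ) {n : ℕ}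
    (xs : Fin n → 𝒳) : ℝ := ∏ i, p μ (xs i)

/-- The law of `n` i.i.d. observations, each with density `f` w.r.t. `ν`. -/
def iidLaw (ν : Measure 𝒳) (f : 𝒳 → ℝ) (n : ℕ) : Measure (Fin n → 𝒳) :=
  (Measure.pi fun _ : Fin n => ν).withDensity fun xs => ENNReal.ofReal (∏ i, f (xs i))

/-- The (raw) maximum likelihood estimator of an exponential family in its mean-value
parameterization: the empirical mean of the sufficient statistic. -/
def mleRaw {m : ℕ} (φ : 𝒳 → (Fin m → ℝ)) {n : ℕ} (xs : Fin n → 𝒳) : Fin m → ℝ :=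
  fun j => (∑ i, φ (xs i) j) / n

/-- Projection `Π₀` onto the simple model: keep the first `m₀` coordinates, replace the
remaining ones by the fixed values. -/
def proj0 {m₁ : ℕ} (m₀ : ℕ) (fixed : Fin m₁ → ℝ) (μ : Fin m₁ → ℝ) : Fin m₁ → ℝ :=
  fun j => if (j : ℕ) < m₀ then μ j else fixed j

/-- The parameter set of the nested submodel `𝓜₀`: the last `m₁ − m₀` coordinates are
fixed to known values. -/
def nestedSub {m₁ : ℕ} (m₀ : ℕ) (M₁ : Set (Fin m₁ → ℝ)) (fixed : Fin m₁ → ℝ) :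
    Set (Fin m₁ → ℝ) := {μ ∈ M₁ | ∀ j : Fin m₁, m₀ ≤ (j : ℕ) → μ j = fixed j}

/-- Embedding of the `m₀`-dimensional parameter of the simple model into `ℝ^{m₁}`. -/
def embed0 {m₀ m₁ : ℕ} (h : m₀ ≤ m₁) (fixed : Fin m₁ → ℝ) (t : Fin m₀ → ℝ) : Fin m₁ → ℝ :=
  fun j => if hj : (j : ℕ) < m₀ then t ⟨(j : ℕ), hj⟩ else fixed j

/-- Bayes marginal density of a sample: `p_B(xⁿ) = ∫_M w(μ) p_μ(xⁿ) dμ`. -/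
def bayesMarginal {m : ℕ} (p : (Fin m → ℝ) → 𝒳 → ℝ) (M : Set (Fin m → ℝ))
    (w : (Fin m → ℝ) → ℝ) {n : ℕ} (xs : Fin n → 𝒳) : ℝ :=
  ∫ μ in M, w μ * likelihood p μ xs

/-- The first `k` observations of a sample of size `n ≥ k`. -/
def prefixObs {n : ℕ} (xs : Fin n → 𝒳) (k : ℕ) (h : k ≤ n) : Fin k → 𝒳 :=
  fun i => xs (Fin.castLE h i)

/-- The strategy `p̄_t` that switches from the simple to the complex model after `t − 1`
observations: `p̄_t(xⁿ) = p_{B,0}(x^{t−1}) · p_{B,1}(x_t,…,x_n | x^{t−1})`. -/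
def pBar (pB0 pB1 : (k : ℕ) → (Fin k → 𝒳) → ℝ) (t : ℕ) {n : ℕ} (xs : Fin n → 𝒳) : ℝ :=
  if h : t - 1 < n then
    pB0 (t - 1) (prefixObs xs (t - 1) h.le) * pB1 n xs / pB1 (t - 1) (prefixObs xs (t - 1) h.le)
  else pB0 n xs

/-- The switch distribution `p_{sw,1}(xⁿ) = Σ_t π(t) p̄_t(xⁿ)`. -/
def pSwitch (pB0 pB1 : (k : ℕ) → (Fin k → 𝒳) → ℝ) (pri : ℕ → ℝ) {n : ℕ} (xs : Fin n → 𝒳) : ℝ :=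
  ∑' t : ℕ, pri t * pBar pB0 pB1 t xs

/-- A prior on switching times supported on powers of two, with `π(2^i) ∝ i^{−κ}`. -/
def SwitchPrior (pri : ℕ → ℝ) (κ : ℝ) : Prop :=
  (∀ t, 0 ≤ pri t) ∧ (∑' t : ℕ, pri t = 1) ∧ (∀ t, pri t ≠ 0 → ∃ i : ℕ, t = 2 ^ i) ∧ 0 < pri 1 ∧
    ∃ c > 0, ∀ i : ℕ, 1 ≤ i → pri (2 ^ i) = c * (i : ℝ) ^ (-κ)

/-- The event (at sample size `n`) that the switch criterion selects the simple model,
i.e. `p_{sw,1}(xⁿ)/p_{B,0}(xⁿ) ≤ 1`. -/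
def swSelectsSimple (pB0 pB1 : (k : ℕ) → (Fin k → 𝒳) → ℝ) (pri : ℕ → ℝ) (n : ℕ) :
    Set (Fin n → 𝒳) := {xs | pSwitch pB0 pB1 pri xs / pB0 n xs ≤ 1}

/-- `small_b(n)`: equal to `1` for `n < b₁` and to `b₂ e^{−b₃ n}` for `n ≥ b₁`. -/
def smallFn (b₁ b₂ b₃ : ℝ) (n : ℕ) : ℝ :=
  if (n : ℝ) < b₁ then 1 else b₂ * Real.exp (-b₃ * n)

/-- Estimators `μ̆₀, μ̆₁` are sufficiently efficient (with constant `C`, on the set `M₁'`)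
w.r.t. the divergence `dgen`: for all `n` and `μ₁ ∈ M₁'`, the risks
`E_{μ₁}[dgen(μ₀, μ̆₀(Xⁿ))]` and `E_{μ₁}[dgen(μ₁, μ̆₁(Xⁿ))]` are bounded by `C/n`,
where `μ₀ = Π₀(μ₁)`. -/
def SuffEff {m₁ : ℕ} (ν : Measure 𝒳) (p : (Fin m₁ → ℝ) → 𝒳 → ℝ) (m₀ : ℕ)
    (fixed : Fin m₁ → ℝ) (M₁' : Set (Fin m₁ → ℝ))
    (dgen : (Fin m₁ → ℝ) → (Fin m₁ → ℝ) → ℝ)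
    (est0 est1 : (n : ℕ) → (Fin n → 𝒳) → (Fin m₁ → ℝ)) (C : ℝ) : Prop :=
  0 < C ∧ ∀ n : ℕ, 0 < n → ∀ μ₁ ∈ M₁',
    (∫ xs, dgen (proj0 m₀ fixed μ₁) (est0 n xs) ∂(iidLaw ν (p μ₁) n)) ≤ C / n ∧
    (∫ xs, dgen μ₁ (est1 n xs) ∂(iidLaw ν (p μ₁) n)) ≤ C / n

end SwitchPaper

namespace SwitchPaper
section aux
set_option linter.unusedSectionVars false
variable {𝒳 : Type*} [MeasurableSpace 𝒳] {m : ℕ} {ν : Measure 𝒳}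
    {M : Set (Fin m → ℝ)} {p : (Fin m → ℝ) → 𝒳 → ℝ}
    {θ : (Fin m → ℝ) → (Fin m → ℝ)} {φ : 𝒳 → (Fin m → ℝ)} {ψ : (Fin m → ℝ) → ℝ}
    {carrier : 𝒳 → ℝ}

/-- log density -/
def lw (θ : (Fin m → ℝ) → (Fin m → ℝ)) (φ : 𝒳 → (Fin m → ℝ)) (ψ : (Fin m → ℝ) → ℝ)
    (μ : Fin m → ℝ) (x : 𝒳) : ℝ := dot (θ μ) (φ x) - ψ (θ μ)

/-- size of the statistic -/
def sz (φ : 𝒳 → (Fin m → ℝ)) (x : 𝒳) : ℝ := ∑ j, |φ x j|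

lemma sz_nonneg (x : 𝒳) : 0 ≤ sz φ x := Finset.sum_nonneg fun _ _ => abs_nonneg _

lemma le_sz (x : 𝒳) (j : Fin m) : |φ x j| ≤ sz φ x :=
  Finset.single_le_sum (f := fun j => |φ x j|) (fun _ _ => abs_nonneg _) (Finset.mem_univ j)

lemma sz_meas (h : Measurable φ) : Measurable (sz φ) := by
  have : ∀ j, Measurable fun x => φ x j := fun j => (measurable_pi_apply j).comp h
  unfold sz
  exact Finset.measurable_fun_sum _ fun j _ => (this j).abs

lemma dot_meas (h : Measurable φ) (v : Fin m → ℝ) : Measurable fun x => dot v (φ x) := by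
  have : ∀ j, Measurable fun x => φ x j := fun j => (measurable_pi_apply j).comp h
  unfold dot
  exact Finset.measurable_fun_sum _ fun j _ => (this j).const_mul _

lemma p_eq (hF : IsMeanValueExpFam ν M p θ φ ψ carrier) {μ : Fin m → ℝ} (hμ : μ ∈ M) (x : 𝒳) :
    p μ x = Real.exp (lw θ φ ψ μ x) * carrier x := hF.p_form μ hμ x

lemma p_pos (hF : IsMeanValueExpFam ν M p θ φ ψ carrier) {μ : Fin m → ℝ} (hμ : μ ∈ M) (x : 𝒳) :
    0 < p μ x := by
  rw [p_eq hF hμ]; exact mul_pos (Real.exp_pos _) (hF.carrier_pos x)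

lemma p_int (hF : IsMeanValueExpFam ν M p θ φ ψ carrier) {μ : Fin m → ℝ} (hμ : μ ∈ M) :
    Integrable (p μ) ν := by
  by_contra h
  have := hF.p_prob μ hμ
  rw [integral_undef h] at this
  norm_num at this

lemma phi_int (hF : IsMeanValueExpFam ν M p θ φ ψ carrier) {μ : Fin m → ℝ} (hμ : μ ∈ M)
    (j : Fin m) : Integrable (fun x => φ x j * p μ x) ν := by
  refine (hF.φ_int μ hμ).mono' ?_ ?_
  · exact (((measurable_pi_apply j).comp hF.φ_meas).mul (hF.p_meas μ)).aestronglyMeasurable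
  · refine Filter.Eventually.of_forall fun x => ?_
    rw [Real.norm_eq_abs, abs_mul, abs_of_pos (p_pos hF hμ x)]
    exact mul_le_mul_of_nonneg_right (le_sz x j) (p_pos hF hμ x).le

lemma dot_int (hF : IsMeanValueExpFam ν M p θ φ ψ carrier) {μ : Fin m → ℝ} (hμ : μ ∈ M)
    (v : Fin m → ℝ) : Integrable (fun x => dot v (φ x) * p μ x) ν ∧
      ∫ x, dot v (φ x) * p μ x ∂ν = dot v μ := by
  have e : (fun x => dot v (φ x) * p μ x) = fun x => ∑ j, v j * (φ x j * p μ x) := by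
    funext x; simp [dot, Finset.sum_mul, mul_assoc]
  rw [e]
  have hi := fun j => (phi_int hF hμ j).const_mul (v j)
  refine ⟨integrable_finsetSum _ fun j _ => hi j, ?_⟩
  rw [integral_finsetSum _ fun j _ => hi j]
  simp [dot, integral_const_mul, hF.mean_eq μ hμ]

lemma lw_int (hF : IsMeanValueExpFam ν M p θ φ ψ carrier) {μ : Fin m → ℝ} (hμ : μ ∈ M)
    (μ₁ : Fin m → ℝ) : Integrable (fun x => lw θ φ ψ μ₁ x * p μ x) ν ∧
      ∫ x, lw θ φ ψ μ₁ x * p μ x ∂ν = dot (θ μ₁) μ - ψ (θ μ₁) := by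
  have h1 := dot_int hF hμ (θ μ₁)
  have h2 := (p_int hF hμ).const_mul (ψ (θ μ₁))
  have e : (fun x => lw θ φ ψ μ₁ x * p μ x) =
      fun x => dot (θ μ₁) (φ x) * p μ x - ψ (θ μ₁) * p μ x := by
    funext x; simp [lw, sub_mul]
  rw [e]
  refine ⟨h1.1.sub h2, ?_⟩
  rw [integral_sub h1.1 h2, h1.2, integral_const_mul, hF.p_prob μ hμ, mul_one]

lemma gibbs (hF : IsMeanValueExpFam ν M p θ φ ψ carrier) {μ₁ μ₂ : Fin m → ℝ} (h₁ : μ₁ ∈ M)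
    (h₂ : μ₂ ∈ M) : dot (θ μ₂) μ₁ - ψ (θ μ₂) ≤ dot (θ μ₁) μ₁ - ψ (θ μ₁) := by
  have a := lw_int hF h₁ μ₂
  have b := lw_int hF h₁ μ₁
  have key : ∫ x, (lw θ φ ψ μ₂ x * p μ₁ x - lw θ φ ψ μ₁ x * p μ₁ x) ∂ν
      ≤ ∫ x, (p μ₂ x - p μ₁ x) ∂ν := by
    refine integral_mono (a.1.sub b.1) ((p_int hF h₂).sub (p_int hF h₁)) fun x => ?_
    simp only [p_eq hF h₁, p_eq hF h₂]
    have h := Real.add_one_le_exp (lw θ φ ψ μ₂ x - lw θ φ ψ μ₁ x)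
    have h3 : Real.exp (lw θ φ ψ μ₂ x) =
        Real.exp (lw θ φ ψ μ₁ x) * Real.exp (lw θ φ ψ μ₂ x - lw θ φ ψ μ₁ x) := by
      rw [← Real.exp_add]; congr 1; ring
    have h4 := mul_le_mul_of_nonneg_left h
      (mul_pos (Real.exp_pos (lw θ φ ψ μ₁ x)) (hF.carrier_pos x)).le
    rw [h3]; linarith
  rw [integral_sub a.1 b.1, a.2, b.2, integral_sub (p_int hF h₂) (p_int hF h₁),
    hF.p_prob _ h₁, hF.p_prob _ h₂] at key
  linarith

lemma mono_id (hF : IsMeanValueExpFam ν M p θ φ ψ carrier) {μ₁ μ₂ : Fin m → ℝ} (h₁ : μ₁ ∈ M)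
    (h₂ : μ₂ ∈ M) :
    Integrable (fun x => (lw θ φ ψ μ₁ x - lw θ φ ψ μ₂ x) * (p μ₁ x - p μ₂ x)) ν ∧
    ∫ x, (lw θ φ ψ μ₁ x - lw θ φ ψ μ₂ x) * (p μ₁ x - p μ₂ x) ∂ν
      = dot (θ μ₁ - θ μ₂) (μ₁ - μ₂) := by
  have a := lw_int hF h₁ μ₁
  have b := lw_int hF h₁ μ₂
  have c := lw_int hF h₂ μ₁
  have d := lw_int hF h₂ μ₂
  have e : (fun x => (lw θ φ ψ μ₁ x - lw θ φ ψ μ₂ x) * (p μ₁ x - p μ₂ x)) =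
      fun x => (lw θ φ ψ μ₁ x * p μ₁ x - lw θ φ ψ μ₂ x * p μ₁ x)
        - (lw θ φ ψ μ₁ x * p μ₂ x - lw θ φ ψ μ₂ x * p μ₂ x) := by
    funext x; ring
  rw [e]
  have ab : Integrable (fun x => lw θ φ ψ μ₁ x * p μ₁ x - lw θ φ ψ μ₂ x * p μ₁ x) ν := a.1.sub b.1
  have cd : Integrable (fun x => lw θ φ ψ μ₁ x * p μ₂ x - lw θ φ ψ μ₂ x * p μ₂ x) ν := c.1.sub d.1
  refine ⟨ab.sub cd, ?_⟩
  rw [integral_sub ab cd, integral_sub a.1 b.1, integral_sub c.1 d.1,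
    a.2, b.2, c.2, d.2]
  have : dot (θ μ₁ - θ μ₂) (μ₁ - μ₂) = dot (θ μ₁) μ₁ - dot (θ μ₂) μ₁ - dot (θ μ₁) μ₂
      + dot (θ μ₂) μ₂ := by
    simp only [dot, Pi.sub_apply, ← Finset.sum_sub_distrib, ← Finset.sum_add_distrib]
    exact Finset.sum_congr rfl fun j _ => by ring
  rw [this]; ring

lemma M_open (hF : IsMeanValueExpFam ν M p θ φ ψ carrier) : IsOpen M := by
  obtain ⟨S, hS, rfl⟩ := hF.M_prod
  exact isOpen_set_pi finite_univ fun j _ => (hS j).1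

lemma M_convex (hF : IsMeanValueExpFam ν M p θ φ ψ carrier) : Convex ℝ M := by
  obtain ⟨S, hS, rfl⟩ := hF.M_prod
  exact convex_pi fun j _ => (hS j).2.convex

lemma dot_add_smul (v a b : Fin m → ℝ) (s t : ℝ) :
    dot v (s • a + t • b) = s * dot v a + t * dot v b := by
  simp only [dot, Pi.add_apply, Pi.smul_apply, smul_eq_mul, Finset.mul_sum,
    ← Finset.sum_add_distrib]
  exact Finset.sum_congr rfl fun j _ => by ring

lemma dot_single (v a : Fin m → ℝ) (j : Fin m) (t : ℝ) :
    dot v (a + Pi.single j t) = dot v a + v j * t := by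
  simp [dot, mul_add, Finset.sum_add_distrib, Pi.single_apply]

/-- dual function -/
def gd (θ : (Fin m → ℝ) → (Fin m → ℝ)) (ψ : (Fin m → ℝ) → ℝ) (μ : Fin m → ℝ) : ℝ :=
  dot (θ μ) μ - ψ (θ μ)

lemma gd_convex (hF : IsMeanValueExpFam ν M p θ φ ψ carrier) : ConvexOn ℝ M (gd θ ψ) := by
  refine ⟨M_convex hF, fun a ha b hb s t hs ht hst => ?_⟩
  have hc := M_convex hF ha hb hs ht hst
  have g1 := mul_le_mul_of_nonneg_left (gibbs hF ha hc) hs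
  have g2 := mul_le_mul_of_nonneg_left (gibbs hF hb hc) ht
  simp only [gd, smul_eq_mul]
  set q := s • a + t • b with hq
  have e : dot (θ q) q = s * dot (θ q) a + t * dot (θ q) b := by
    conv_lhs => rw [hq]
    exact dot_add_smul _ _ _ _ _
  have e2 : ψ (θ q) = s * ψ (θ q) + t * ψ (θ q) := by rw [← add_mul, hst, one_mul]
  rw [e]
  linarith

lemma gd_sub (hF : IsMeanValueExpFam ν M p θ φ ψ carrier) {μ₁ μ₂ : Fin m → ℝ} (h₁ : μ₁ ∈ M)
    (h₂ : μ₂ ∈ M) : dot (θ μ₁) μ₂ - dot (θ μ₁) μ₁ ≤ gd θ ψ μ₂ - gd θ ψ μ₁ := by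
  have := gibbs hF h₂ h₁
  simp only [gd]; linarith

/-- local control -/
def Loc (M : Set (Fin m → ℝ)) (θ : (Fin m → ℝ) → (Fin m → ℝ)) (ψ : (Fin m → ℝ) → ℝ)
    (U : Set (Fin m → ℝ)) (K : ℝ) : Prop :=
  ∀ μ ∈ U, μ ∈ M ∧ (∀ j, |θ μ j| ≤ K) ∧ |ψ (θ μ)| ≤ K

lemma dot_abs_le (v : Fin m → ℝ) {K : ℝ} (hv : ∀ j, |v j| ≤ K) (a : Fin m → ℝ) :
    |dot v a| ≤ K * ∑ j, |a j| := by
  unfold dot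
  refine (Finset.abs_sum_le_sum_abs _ _).trans ?_
  rw [Finset.mul_sum]
  refine Finset.sum_le_sum fun j _ => ?_
  rw [abs_mul]
  exact mul_le_mul_of_nonneg_right (hv j) (abs_nonneg _)

lemma exists_loc (hF : IsMeanValueExpFam ν M p θ φ ψ carrier) {μ₀ : Fin m → ℝ} (h₀ : μ₀ ∈ M) :
    ∃ ε > 0, ∃ K > 0, Loc M θ ψ (Metric.ball μ₀ ε) K := by
  have hc : ContinuousAt (gd θ ψ) μ₀ :=
    ((gd_convex hF).continuousOn (M_open hF)).continuousAt ((M_open hF).mem_nhds h₀)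
  obtain ⟨δ, hδ, hb⟩ := Metric.mem_nhds_iff.1
    (Filter.inter_mem ((M_open hF).mem_nhds h₀) (hc (Metric.ball_mem_nhds _ one_pos)))
  set B := |gd θ ψ μ₀| + 1 with hB
  have hB' : ∀ μ ∈ Metric.ball μ₀ δ, |gd θ ψ μ| ≤ B := by
    intro μ hμ
    have := (hb hμ).2
    simp only [mem_preimage, Metric.mem_ball, Real.dist_eq] at this
    have h2 := abs_sub_abs_le_abs_sub (gd θ ψ μ) (gd θ ψ μ₀)
    linarith
  have hθ : ∀ μ ∈ Metric.ball μ₀ (δ/2), ∀ j, |θ μ j| ≤ 2 * B / (δ/4) := by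
    intro μ hμ j
    have hμ' : μ ∈ Metric.ball μ₀ δ := Metric.ball_subset_ball (by linarith) hμ
    have aux : ∀ t : ℝ, |t| = δ/4 → θ μ j * t ≤ 2 * B := by
      intro t ht
      have hm : μ + Pi.single j t ∈ Metric.ball μ₀ δ := by
        rw [Metric.mem_ball] at hμ ⊢
        have h1 : dist (μ + Pi.single j t) μ = |t| := by
          rw [dist_eq_norm]; simp [Pi.norm_single]
        have := dist_triangle (μ + Pi.single j t) μ μ₀
        linarith
      have h1 := gd_sub hF (hb hμ').1 (hb hm).1
      rw [dot_single] at h1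
      have h2 := abs_le.1 (hB' _ hμ')
      have h3 := abs_le.1 (hB' _ hm)
      linarith [h2.1, h3.2]
    rw [le_div_iff₀ (by linarith)]
    have a1 := aux (δ/4) (abs_of_pos (by linarith))
    have a2 := aux (-(δ/4)) (by rw [abs_neg]; exact abs_of_pos (by linarith))
    rcases abs_cases (θ μ j) with h | h <;> rw [h.1] <;> linarith
  set K := 2 * B / (δ/4) with hK
  have hK0 : 0 < K := by positivity
  refine ⟨δ/2, by linarith, K + (K * ∑ j : Fin m, (|μ₀ j| + δ) + B), by positivity, fun μ hμ => ?_⟩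
  have hμ' : μ ∈ Metric.ball μ₀ δ := Metric.ball_subset_ball (by linarith) hμ
  have hS : ∑ j : Fin m, |μ j| ≤ ∑ j : Fin m, (|μ₀ j| + δ) := by
    refine Finset.sum_le_sum fun j _ => ?_
    have := (dist_le_pi_dist μ μ₀ j).trans (Metric.mem_ball.1 hμ').le
    rw [Real.dist_eq] at this
    linarith [abs_sub_abs_le_abs_sub (μ j) (μ₀ j)]
  have hS0 : 0 ≤ ∑ j : Fin m, |μ j| := Finset.sum_nonneg fun _ _ => abs_nonneg _
  refine ⟨(hb hμ').1, fun j => (hθ μ hμ j).trans ?_, ?_⟩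
  · have : 0 ≤ K * ∑ j : Fin m, (|μ₀ j| + δ) := by positivity
    have : 0 ≤ B := by positivity
    linarith
  · have h1 := dot_abs_le (θ μ) (hθ μ hμ) μ
    have h2 := hB' μ hμ'
    have h3 : ψ (θ μ) = dot (θ μ) μ - gd θ ψ μ := by simp [gd]
    rw [h3]
    have h4 := abs_sub (dot (θ μ) μ) (gd θ ψ μ)
    have h5 := mul_le_mul_of_nonneg_left hS hK0.le
    linarith

lemma lw_bound {U : Set (Fin m → ℝ)} {K : ℝ} (hL : Loc M θ ψ U K) {μ : Fin m → ℝ} (hμ : μ ∈ U)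
    (x : 𝒳) : |lw θ φ ψ μ x| ≤ K * (1 + sz φ x) := by
  have h1 := dot_abs_le (θ μ) (hL μ hμ).2.1 (φ x)
  have h2 := (hL μ hμ).2.2
  have h3 := abs_sub (dot (θ μ) (φ x)) (ψ (θ μ))
  unfold lw sz
  linarith

lemma quad_min {n : ℕ} (A : Matrix (Fin n) (Fin n) ℝ) (hA : ∀ v, v ≠ 0 → 0 < quadForm A v) :
    ∃ c > 0, ∀ v, c * ∑ i, v i ^ 2 ≤ quadForm A v := by
  have hc : Continuous (quadForm A) := by unfold quadForm; fun_prop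
  have hcs : Continuous (fun v : Fin n → ℝ => ∑ i, v i ^ 2) := by fun_prop
  by_cases hn : (Metric.sphere (0 : Fin n → ℝ) 1).Nonempty
  · obtain ⟨v₀, hv₀, hmin⟩ := (isCompact_sphere (0 : Fin n → ℝ) 1).exists_isMinOn hn hc.continuousOn
    obtain ⟨v₁, hv₁, hmax⟩ := (isCompact_sphere (0 : Fin n → ℝ) 1).exists_isMaxOn hn hcs.continuousOn
    have hne : v₀ ≠ 0 := by
      rintro rfl; simp at hv₀
    have hq := hA v₀ hne
    set B := ∑ i, v₁ i ^ 2 with hB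
    have hB0 : 0 ≤ B := Finset.sum_nonneg fun _ _ => sq_nonneg _
    refine ⟨quadForm A v₀ / (B + 1), by positivity, fun v => ?_⟩
    by_cases hv : v = 0
    · subst hv; simp [quadForm]
    have hnv : 0 < ‖v‖ := norm_pos_iff.2 hv
    set u := ‖v‖⁻¹ • v with hu
    have hus : u ∈ Metric.sphere (0 : Fin n → ℝ) 1 := by
      simp [hu, norm_smul, hnv.ne']
    have h1 : quadForm A v₀ ≤ quadForm A u := hmin hus
    have h2 : ∑ i, u i ^ 2 ≤ B := hmax hus
    have hvu : v = ‖v‖ • u := by simp [hu, smul_smul, hnv.ne']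
    have e1 : quadForm A v = ‖v‖ ^ 2 * quadForm A u := by
      conv_lhs => rw [hvu]
      simp only [quadForm, Pi.smul_apply, smul_eq_mul, Finset.mul_sum]
      exact Finset.sum_congr rfl fun i _ => Finset.sum_congr rfl fun j _ => by ring
    have e2 : ∑ i, v i ^ 2 = ‖v‖ ^ 2 * ∑ i, u i ^ 2 := by
      conv_lhs => rw [hvu]
      simp only [Pi.smul_apply, smul_eq_mul, Finset.mul_sum]
      exact Finset.sum_congr rfl fun i _ => by ring
    rw [e1, e2]
    have h3 : quadForm A v₀ / (B + 1) * ∑ i, u i ^ 2 ≤ quadForm A u := by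
      rw [div_mul_eq_mul_div, div_le_iff₀ (by linarith)]
      nlinarith
    nlinarith [sq_nonneg ‖v‖, mul_le_mul_of_nonneg_left h3 (sq_nonneg ‖v‖)]
  · refine ⟨1, one_pos, fun v => ?_⟩
    by_cases hv : v = 0
    · subst hv; simp [quadForm]
    exfalso; apply hn
    have hnv : 0 < ‖v‖ := norm_pos_iff.2 hv
    exact ⟨‖v‖⁻¹ • v, by simp [norm_smul, hnv.ne']⟩


lemma quad_integral {n : ℕ} (Φ : 𝒳 → Fin n → ℝ) (q : 𝒳 → ℝ)
    (hi : ∀ i j, Integrable (fun x => Φ x i * Φ x j * q x) ν) (v : Fin n → ℝ) :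
    Integrable (fun x => (dot v (Φ x)) ^ 2 * q x) ν ∧
    quadForm (Matrix.of fun i j => ∫ x, Φ x i * Φ x j * q x ∂ν) v
      = ∫ x, (dot v (Φ x)) ^ 2 * q x ∂ν := by
  have e : (fun x => (dot v (Φ x)) ^ 2 * q x) =
      fun x => ∑ i, ∑ j, v i * v j * (Φ x i * Φ x j * q x) := by
    funext x
    simp only [dot]
    rw [sq, Finset.sum_mul_sum, Finset.sum_mul]
    simp only [Finset.sum_mul]
    exact Finset.sum_congr rfl fun i _ => Finset.sum_congr rfl fun j _ => by ring
  have h1 := fun i j => (hi i j).const_mul (v i * v j)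
  have h2 : ∀ i, Integrable (fun x => ∑ j, v i * v j * (Φ x i * Φ x j * q x)) ν :=
    fun i => integrable_finsetSum _ fun j _ => h1 i j
  rw [e]
  refine ⟨integrable_finsetSum _ fun i _ => h2 i, ?_⟩
  rw [integral_finsetSum _ fun i _ => h2 i]
  unfold quadForm
  refine Finset.sum_congr rfl fun i _ => ?_
  rw [integral_finsetSum _ fun j _ => h1 i j]
  refine Finset.sum_congr rfl fun j _ => ?_
  rw [integral_const_mul]
  simp only [Matrix.of_apply]; ring

/-- common lower weight -/
def gw (φ : 𝒳 → (Fin m → ℝ)) (carrier : 𝒳 → ℝ) (K : ℝ) (x : 𝒳) : ℝ :=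
  Real.exp (-((K + 1) * (1 + sz φ x))) * carrier x

lemma lw_meas (h : Measurable φ) (μ : Fin m → ℝ) : Measurable (lw θ φ ψ μ) :=
  (dot_meas h _).sub_const _

lemma carrier_meas (hF : IsMeanValueExpFam ν M p θ φ ψ carrier) : Measurable carrier := by
  obtain ⟨μ, hμ⟩ := hF.M_conn.nonempty
  have : carrier = fun x => p μ x * Real.exp (-(lw θ φ ψ μ x)) := by
    funext x
    rw [p_eq hF hμ, mul_right_comm, ← Real.exp_add]; simp
  rw [this]
  exact (hF.p_meas μ).mul ((lw_meas hF.φ_meas μ).neg.exp)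

lemma gw_pos (hF : IsMeanValueExpFam ν M p θ φ ψ carrier) (K : ℝ) (x : 𝒳) :
    0 < gw φ carrier K x := mul_pos (Real.exp_pos _) (hF.carrier_pos x)

lemma gw_int (hF : IsMeanValueExpFam ν M p θ φ ψ carrier) {U : Set (Fin m → ℝ)} {K : ℝ}
    (hL : Loc M θ ψ U K) {μ₀ : Fin m → ℝ} (h₀ : μ₀ ∈ U) (f : 𝒳 → ℝ) (hf : Measurable f)
    (hb : ∀ x, |f x| ≤ (1 + sz φ x) ^ 2) : Integrable (fun x => f x * gw φ carrier K x) ν := by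
  have hM := (hL μ₀ h₀).1
  refine ((p_int hF hM).const_mul 2).mono' ?_ ?_
  · refine (hf.mul ?_).aestronglyMeasurable
    exact (((sz_meas hF.φ_meas).const_add 1).const_mul _).neg.exp.mul (carrier_meas hF)
  · refine Filter.Eventually.of_forall fun x => ?_
    rw [Real.norm_eq_abs, abs_mul, abs_of_pos (gw_pos hF K x), gw, p_eq hF hM]
    have h1 := (abs_le.1 (lw_bound (φ := φ) hL h₀ x)).1
    have h2 : 0 ≤ 1 + sz φ x := by linarith [sz_nonneg (φ := φ) x]
    have h3 := Real.quadratic_le_exp_of_nonneg h2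
    have h4 : Real.exp (-((K + 1) * (1 + sz φ x))) * Real.exp (1 + sz φ x)
        = Real.exp (-(K * (1 + sz φ x))) := by rw [← Real.exp_add]; congr 1; ring
    have h5 : Real.exp (-(K * (1 + sz φ x))) ≤ Real.exp (lw θ φ ψ μ₀ x) := Real.exp_le_exp.2 h1
    have h6 : |f x| ≤ 2 * Real.exp (1 + sz φ x) := by
      refine (hb x).trans ?_; linarith
    have h7 := mul_le_mul_of_nonneg_right h6 (Real.exp_pos (-((K + 1) * (1 + sz φ x)))).le
    have h8 : |f x| * Real.exp (-((K + 1) * (1 + sz φ x))) ≤ 2 * Real.exp (lw θ φ ψ μ₀ x) := by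
      nlinarith
    have := mul_le_mul_of_nonneg_right h8 (hF.carrier_pos x).le
    linarith

lemma nondeg (hF : IsMeanValueExpFam ν M p θ φ ψ carrier) (v : Fin m → ℝ) (s : ℝ)
    (h : ∀ᵐ x ∂ν, dot v (φ x) = s) : v = 0 ∧ s = 0 := by
  have key : ∀ μ ∈ M, dot v μ = s := by
    intro μ hμ
    rw [← (dot_int hF hμ v).2]
    have : ∫ x, dot v (φ x) * p μ x ∂ν = ∫ x, s * p μ x ∂ν :=
      integral_congr_ae (h.mono fun x hx => by simp only [hx])
    rw [this, integral_const_mul, hF.p_prob μ hμ, mul_one]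
  obtain ⟨μ, hμ⟩ := hF.M_conn.nonempty
  have hv : v = 0 := by
    obtain ⟨ε, hε, hb⟩ := Metric.mem_nhds_iff.1 ((M_open hF).mem_nhds hμ)
    funext j
    have hm : μ + Pi.single j (ε/2) ∈ M := by
      apply hb
      rw [Metric.mem_ball, dist_eq_norm]
      simp only [add_sub_cancel_left, Pi.norm_single, Real.norm_eq_abs]
      rw [abs_of_pos (by linarith)]; linarith
    have h1 := key _ hm
    rw [dot_single, key _ hμ] at h1
    have : v j * (ε/2) = 0 := by linarith
    rcases mul_eq_zero.1 this with h | h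
    · exact h
    · linarith
  refine ⟨hv, ?_⟩
  rw [← key μ hμ, hv]; simp [dot]

lemma exists_c (hF : IsMeanValueExpFam ν M p θ φ ψ carrier) {U : Set (Fin m → ℝ)} {K : ℝ}
    (hL : Loc M θ ψ U K) {μ₀ : Fin m → ℝ} (h₀ : μ₀ ∈ U) :
    ∃ c > 0, ∀ (v : Fin m → ℝ) (s : ℝ),
      Integrable (fun x => (dot v (φ x) - s) ^ 2 * gw φ carrier K x) ν ∧
      c * ∑ j, v j ^ 2 ≤ ∫ x, (dot v (φ x) - s) ^ 2 * gw φ carrier K x ∂ν := by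
  set Φ : 𝒳 → Fin (m + 1) → ℝ := fun x => Fin.cons 1 (φ x) with hΦ
  have hm : ∀ i, Measurable fun x => Φ x i := by
    intro i
    refine Fin.cases ?_ (fun j => ?_) i
    · simp [hΦ]
    · have h1 : Measurable fun x => φ x j := (measurable_pi_apply j).comp hF.φ_meas
      simpa [hΦ] using h1
  have hbd : ∀ x i, |Φ x i| ≤ 1 + sz φ x := by
    intro x i
    refine Fin.cases ?_ (fun j => ?_) i
    · simp [hΦ, sz_nonneg]
    · have := le_sz (φ := φ) x j
      simp only [hΦ, Fin.cons_succ]; linarith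
  have hi : ∀ i j, Integrable (fun x => Φ x i * Φ x j * gw φ carrier K x) ν := by
    intro i j
    refine gw_int hF hL h₀ (fun x => Φ x i * Φ x j) ((hm i).mul (hm j)) fun x => ?_
    rw [abs_mul, sq]
    exact mul_le_mul (hbd x i) (hbd x j) (abs_nonneg _) (by linarith [sz_nonneg (φ := φ) x])
  have hq := quad_integral (ν := ν) Φ (gw φ carrier K) hi
  have hdot : ∀ (u : Fin (m+1) → ℝ) x, dot u (Φ x) = dot (Fin.tail u) (φ x) - (- u 0) := by
    intro u x
    simp only [dot, Fin.sum_univ_succ, hΦ, Fin.cons_zero, Fin.cons_succ, Fin.tail]; ring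
  obtain ⟨c, hc, hmin⟩ := quad_min _ (fun u hu => by
    rw [(hq u).2]
    have hnn : ∀ x, 0 ≤ dot u (Φ x) ^ 2 * gw φ carrier K x := fun x =>
      mul_nonneg (sq_nonneg _) (gw_pos hF K x).le
    refine lt_of_le_of_ne (integral_nonneg hnn) fun h0 => hu ?_
    have := (integral_eq_zero_iff_of_nonneg hnn (hq u).1).1 h0.symm
    have h2 : ∀ᵐ x ∂ν, dot (Fin.tail u) (φ x) = - u 0 := by
      filter_upwards [this] with x hx
      simp only [Pi.zero_apply, mul_eq_zero, (gw_pos hF K x).ne', or_false] at hx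
      have := pow_eq_zero_iff (two_ne_zero) |>.1 hx
      rw [hdot] at this; linarith
    obtain ⟨h3, h4⟩ := nondeg hF _ _ h2
    funext i
    refine Fin.cases ?_ (fun j => ?_) i
    · simpa using h4
    · exact congrFun h3 j)
  refine ⟨c, hc, fun v s => ?_⟩
  have e : ∀ x, dot v (φ x) - s = dot (Fin.cons (-s) v : Fin (m+1) → ℝ) (Φ x) := by
    intro x; rw [hdot]; simp
  simp only [e]
  refine ⟨(hq _).1, ?_⟩
  have := hmin (Fin.cons (-s) v)
  rw [(hq _).2, Fin.sum_univ_succ] at this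
  simp only [Fin.cons_zero, Fin.cons_succ] at this
  nlinarith [sq_nonneg (-s)]

lemma gw_le (hF : IsMeanValueExpFam ν M p θ φ ψ carrier) {U : Set (Fin m → ℝ)} {K : ℝ}
    (hL : Loc M θ ψ U K) {μ : Fin m → ℝ} (h : μ ∈ U) (x : 𝒳) : gw φ carrier K x ≤ p μ x := by
  rw [gw, p_eq hF (hL μ h).1]
  refine mul_le_mul_of_nonneg_right (Real.exp_le_exp.2 ?_) (hF.carrier_pos x).le
  have h1 := (abs_le.1 (lw_bound (φ := φ) hL h x)).1
  have h2 := sz_nonneg (φ := φ) x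
  linarith

lemma exp_aux (a b k : ℝ) (ha : -k ≤ a) (hb : -k ≤ b) :
    (a - b) ^ 2 * Real.exp (-k) ≤ (a - b) * (Real.exp a - Real.exp b) := by
  wlog hab : b ≤ a generalizing a b
  · have := this b a hb ha (le_of_not_ge hab)
    linarith
  have h1 : Real.exp b * (a - b) ≤ Real.exp a - Real.exp b := by
    have h := Real.add_one_le_exp (a - b)
    have h3 : Real.exp a = Real.exp b * Real.exp (a - b) := by
      rw [← Real.exp_add]; congr 1; ring
    rw [h3]; nlinarith [Real.exp_pos b]
  have h2 : Real.exp (-k) ≤ Real.exp b := Real.exp_le_exp.2 hb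
  have h3 : 0 ≤ a - b := by linarith
  have h4 := mul_le_mul_of_nonneg_left h1 h3
  have h5 := mul_le_mul_of_nonneg_left h2 (sq_nonneg (a-b))
  linarith

lemma strong_mono (hF : IsMeanValueExpFam ν M p θ φ ψ carrier) {U : Set (Fin m → ℝ)} {K : ℝ}
    (hL : Loc M θ ψ U K) {c : ℝ} (hc : ∀ (v : Fin m → ℝ) (s : ℝ),
      Integrable (fun x => (dot v (φ x) - s) ^ 2 * gw φ carrier K x) ν ∧
      c * ∑ j, v j ^ 2 ≤ ∫ x, (dot v (φ x) - s) ^ 2 * gw φ carrier K x ∂ν)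
    {μ₁ μ₂ : Fin m → ℝ} (h₁ : μ₁ ∈ U) (h₂ : μ₂ ∈ U) :
    c * ∑ j, (θ μ₁ j - θ μ₂ j) ^ 2 ≤ dot (θ μ₁ - θ μ₂) (μ₁ - μ₂) := by
  have hm := mono_id hF (hL _ h₁).1 (hL _ h₂).1
  rw [← hm.2]
  have h := hc (θ μ₁ - θ μ₂) (ψ (θ μ₁) - ψ (θ μ₂))
  refine h.2.trans (integral_mono h.1 hm.1 fun x => ?_)
  have e : dot (θ μ₁ - θ μ₂) (φ x) - (ψ (θ μ₁) - ψ (θ μ₂))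
      = lw θ φ ψ μ₁ x - lw θ φ ψ μ₂ x := by
    simp only [lw, dot, Pi.sub_apply, sub_mul, Finset.sum_sub_distrib]; ring
  simp only [e, p_eq hF (hL _ h₁).1, p_eq hF (hL _ h₂).1, gw]
  have hs := sz_nonneg (φ := φ) x
  have := exp_aux (lw θ φ ψ μ₁ x) (lw θ φ ψ μ₂ x) ((K + 1) * (1 + sz φ x))
    (by linarith [(abs_le.1 (lw_bound (φ := φ) hL h₁ x)).1])
    (by linarith [(abs_le.1 (lw_bound (φ := φ) hL h₂ x)).1])
  have := mul_le_mul_of_nonneg_right this (hF.carrier_pos x).le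
  linarith

lemma hell_aux (a b : ℝ) : (Real.exp (a/2) - Real.exp (b/2)) ^ 2 ≤
    (a - b) * (Real.exp a - Real.exp b) := by
  wlog hab : b ≤ a generalizing a b
  · have := this b a (le_of_not_ge hab)
    linarith
  have h := Real.add_one_le_exp (b/2 - a/2)
  have ea : Real.exp a = Real.exp (a/2) * Real.exp (a/2) := by rw [← Real.exp_add]; congr 1; ring
  have eb : Real.exp b = Real.exp (b/2) * Real.exp (b/2) := by rw [← Real.exp_add]; congr 1; ring
  have eab : Real.exp (b/2) = Real.exp (a/2) * Real.exp (b/2 - a/2) := by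
    rw [← Real.exp_add]; congr 1; ring
  have hle : Real.exp (b/2) ≤ Real.exp (a/2) := Real.exp_le_exp.2 (by linarith)
  have pa := Real.exp_pos (a/2)
  have pb := Real.exp_pos (b/2)
  have h1 : Real.exp (a/2) - Real.exp (b/2) ≤ Real.exp (a/2) * ((a - b)/2) := by
    rw [eab]; nlinarith
  rw [ea, eb]
  have h2 := mul_le_mul_of_nonneg_left h1 (sub_nonneg.2 hle)
  have h3 : 0 ≤ (Real.exp (a/2) - Real.exp (b/2)) * (a - b) :=
    mul_nonneg (sub_nonneg.2 hle) (by linarith)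
  nlinarith [mul_nonneg h3 pa.le, mul_nonneg h3 pb.le]

lemma hell (hF : IsMeanValueExpFam ν M p θ φ ψ carrier) {μ₁ μ₂ : Fin m → ℝ} (h₁ : μ₁ ∈ M)
    (h₂ : μ₂ ∈ M) : dH2 ν (p μ₁) (p μ₂) ≤ dot (θ μ₁ - θ μ₂) (μ₁ - μ₂) ∧
      dH2 ν (p μ₁) (p μ₂) ≤ 2 := by
  have hm := mono_id hF h₁ h₂
  have hsi : Integrable (fun x => Real.sqrt (p μ₁ x * p μ₂ x)) ν := by
    refine ((p_int hF h₁).add (p_int hF h₂)).mono' ?_ ?_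
    · exact ((hF.p_meas μ₁).mul (hF.p_meas μ₂)).sqrt.aestronglyMeasurable
    · refine Filter.Eventually.of_forall fun x => ?_
      have p1 := p_pos hF h₁ x
      have p2 := p_pos hF h₂ x
      rw [Real.norm_eq_abs, abs_of_nonneg (Real.sqrt_nonneg _)]
      refine Real.sqrt_le_iff.2 ⟨?_, ?_⟩ <;> simp only [Pi.add_apply]
      · positivity
      · nlinarith
  constructor
  · have h12 : Integrable (fun x => p μ₁ x + p μ₂ x) ν := (p_int hF h₁).add (p_int hF h₂)
    have e : dH2 ν (p μ₁) (p μ₂) = ∫ x, (p μ₁ x + p μ₂ x - 2 * Real.sqrt (p μ₁ x * p μ₂ x)) ∂ν := by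
      rw [integral_sub h12 (hsi.const_mul 2), integral_add (p_int hF h₁) (p_int hF h₂),
        hF.p_prob _ h₁, hF.p_prob _ h₂, integral_const_mul, dH2, hellingerAffinity]
      ring
    rw [e, ← hm.2]
    refine integral_mono (h12.sub (hsi.const_mul 2)) hm.1 fun x => ?_
    have hc := hF.carrier_pos x
    have hs : Real.sqrt (p μ₁ x * p μ₂ x) =
        Real.exp (lw θ φ ψ μ₁ x / 2) * Real.exp (lw θ φ ψ μ₂ x / 2) * carrier x := by
      rw [Real.sqrt_eq_iff_mul_self_eq (mul_pos (p_pos hF h₁ x) (p_pos hF h₂ x)).le (by positivity),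
        p_eq hF h₁, p_eq hF h₂, ← Real.exp_add, ← add_div]
      have : Real.exp (lw θ φ ψ μ₁ x) * carrier x * (Real.exp (lw θ φ ψ μ₂ x) * carrier x)
        = Real.exp (lw θ φ ψ μ₁ x + lw θ φ ψ μ₂ x) * (carrier x * carrier x) := by
        rw [Real.exp_add]; ring
      rw [this, mul_mul_mul_comm, ← Real.exp_add, add_halves]
    change p μ₁ x + p μ₂ x - 2 * Real.sqrt (p μ₁ x * p μ₂ x) ≤
      (lw θ φ ψ μ₁ x - lw θ φ ψ μ₂ x) * (p μ₁ x - p μ₂ x)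
    rw [hs, p_eq hF h₁, p_eq hF h₂]
    have h := mul_le_mul_of_nonneg_right (hell_aux (lw θ φ ψ μ₁ x) (lw θ φ ψ μ₂ x)) hc.le
    have ea : Real.exp (lw θ φ ψ μ₁ x) = Real.exp (lw θ φ ψ μ₁ x/2) * Real.exp (lw θ φ ψ μ₁ x/2) := by
      rw [← Real.exp_add]; congr 1; ring
    have eb : Real.exp (lw θ φ ψ μ₂ x) = Real.exp (lw θ φ ψ μ₂ x/2) * Real.exp (lw θ φ ψ μ₂ x/2) := by
      rw [← Real.exp_add]; congr 1; ring
    rw [ea, eb] at h ⊢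
    linarith
  · have : 0 ≤ hellingerAffinity ν (p μ₁) (p μ₂) := integral_nonneg fun x => Real.sqrt_nonneg _
    unfold dH2; linarith


lemma quadForm_eq (A : Matrix (Fin m) (Fin m) ℝ) (v : Fin m → ℝ) :
    quadForm A v = dotProduct v (A.mulVec v) := by
  simp only [quadForm, dotProduct, Matrix.mulVec, Finset.mul_sum, mul_assoc]

lemma inv_bounds (A : Matrix (Fin m) (Fin m) ℝ) (hs : A.transpose = A) {a b : ℝ} (ha : 0 < a)
    (hb : 0 < b) (h1 : ∀ v, a * ∑ j, v j ^ 2 ≤ quadForm A v)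
    (h2 : ∀ v, quadForm A v ≤ b * ∑ j, v j ^ 2) (y : Fin m → ℝ) :
    (1 / b) * ∑ j, y j ^ 2 ≤ quadForm A⁻¹ y ∧ quadForm A⁻¹ y ≤ (1 / a) * ∑ j, y j ^ 2 := by
  have hss : ∀ v : Fin m → ℝ, ∑ j, v j ^ 2 = dotProduct v v := fun v => by
    simp only [dotProduct, sq]
  simp only [hss, quadForm_eq] at h1 h2 ⊢
  have hinj : Function.Injective A.mulVec := by
    intro u v huv
    have h0 : A.mulVec (u - v) = 0 := by rw [Matrix.mulVec_sub, huv, sub_self]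
    have h3 := h1 (u - v)
    rw [h0, dotProduct_zero] at h3
    have h4 : dotProduct (u - v) (u - v) = 0 := by
      have : 0 ≤ dotProduct (u - v) (u - v) := by
        rw [← hss]; exact Finset.sum_nonneg fun _ _ => sq_nonneg _
      nlinarith
    exact sub_eq_zero.1 (dotProduct_self_eq_zero.1 h4)
  have hu : IsUnit A := Matrix.mulVec_injective_iff_isUnit.1 hinj
  have hd : IsUnit A.det := (Matrix.isUnit_iff_isUnit_det A).1 hu
  set x := A⁻¹.mulVec y with hx
  have hAx : A.mulVec x = y := by
    rw [hx, Matrix.mulVec_mulVec, Matrix.mul_nonsing_inv A hd, Matrix.one_mulVec]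
  have nn : ∀ v : Fin m → ℝ, 0 ≤ dotProduct v v := fun v => by
    rw [← hss]; exact Finset.sum_nonneg fun _ _ => sq_nonneg _
  constructor
  · have h3 := h1 (x - (1/b) • y)
    have h4 := mul_nonneg ha.le (nn (x - (1/b) • y))
    have h5 := h2 y
    have hsym : dotProduct x (A.mulVec y) = dotProduct y y := by
      rw [Matrix.dotProduct_mulVec, ← Matrix.mulVec_transpose, hs, hAx]
    rw [Matrix.mulVec_sub, Matrix.mulVec_smul, hAx] at h3
    simp only [sub_dotProduct, dotProduct_sub, smul_dotProduct, dotProduct_smul, smul_eq_mul,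
      hsym] at h3
    rw [dotProduct_comm x y] at h3
    have h6 : (1/b) * ((1/b) * dotProduct y (A.mulVec y)) ≤ (1/b) * dotProduct y y := by
      have h7 : 0 < 1/b := by positivity
      refine mul_le_mul_of_nonneg_left ?_ h7.le
      have := mul_le_mul_of_nonneg_left h5 h7.le
      rwa [← mul_assoc, one_div_mul_cancel hb.ne', one_mul] at this
    simp only [sub_dotProduct, dotProduct_sub, smul_dotProduct, dotProduct_smul, smul_eq_mul] at h4
    have h8 : 0 ≤ a * dotProduct (x - (1/b) • y) (x - (1/b) • y) :=
      mul_nonneg ha.le (nn _)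
    simp only [sub_dotProduct, dotProduct_sub, smul_dotProduct, dotProduct_smul, smul_eq_mul] at h8
    rw [dotProduct_comm x y] at h8
    linarith
  · have h3 := h1 x
    rw [hAx] at h3
    have h4 := nn ((1/a) • y - x)
    simp only [sub_dotProduct, dotProduct_sub, smul_dotProduct, dotProduct_smul, smul_eq_mul] at h4
    rw [dotProduct_comm x y] at h4 h3
    have h5 := mul_nonneg ha.le h4
    have e1 : a * (1 / a * (1 / a * (y ⬝ᵥ y))) = 1 / a * (y ⬝ᵥ y) := by field_simp
    have e2 : a * (1 / a * (y ⬝ᵥ x)) = (y ⬝ᵥ x) := by field_simp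
    rw [mul_sub, mul_sub, mul_sub, e1, e2] at h5
    linarith

lemma dir_pos (hF : IsMeanValueExpFam ν M p θ φ ψ carrier) {μ₀ : Fin m → ℝ} (h₀ : μ₀ ∈ M)
    (v : Fin m → ℝ) (hv : v ≠ 0) : ∃ μ ∈ M, 0 < dot v (θ μ - θ μ₀) := by
  obtain ⟨ε, hε, K, hK, hL⟩ := exists_loc hF h₀
  have h00 : μ₀ ∈ Metric.ball μ₀ ε := Metric.mem_ball_self hε
  obtain ⟨c, hc, hcc⟩ := exists_c hF hL h00
  have hn : 0 < ‖v‖ := norm_pos_iff.2 hv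
  set t := ε / (2 * ‖v‖) with ht
  have ht0 : 0 < t := by positivity
  have hm : μ₀ + t • v ∈ Metric.ball μ₀ ε := by
    rw [Metric.mem_ball, dist_eq_norm, add_sub_cancel_left, norm_smul, Real.norm_eq_abs,
      abs_of_pos ht0, ht]
    have : ε / (2 * ‖v‖) * ‖v‖ = ε / 2 := by field_simp
    rw [this]; linarith
  have hM := (hL _ hm).1
  refine ⟨_, hM, ?_⟩
  by_contra hneg
  have h1 := strong_mono hF hL hcc hm h00
  have e : dot (θ (μ₀ + t • v) - θ μ₀) (μ₀ + t • v - μ₀) = t * dot v (θ (μ₀ + t • v) - θ μ₀) := by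
    rw [add_sub_cancel_left]
    simp only [dot, Pi.smul_apply, smul_eq_mul, Finset.mul_sum]
    exact Finset.sum_congr rfl fun j _ => by ring
  rw [e] at h1
  have h2 : ∑ j, (θ (μ₀ + t • v) j - θ μ₀ j) ^ 2 ≤ 0 := by
    by_contra h3
    push Not at h3 hneg
    nlinarith [mul_pos hc h3]
  have h3 : θ (μ₀ + t • v) = θ μ₀ := by
    funext j
    have h4 := (Finset.sum_eq_zero_iff_of_nonneg (fun j _ => sq_nonneg _)).1
      (le_antisymm h2 (Finset.sum_nonneg fun j _ => sq_nonneg _)) j (Finset.mem_univ j)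
    exact sub_eq_zero.1 (pow_eq_zero_iff two_ne_zero |>.1 h4)
  have h4 : p (μ₀ + t • v) = p μ₀ := by
    funext x; rw [hF.p_form _ hM, hF.p_form _ h₀, h3]
  have h5 : μ₀ + t • v = μ₀ := by
    funext j
    rw [← hF.mean_eq _ hM j, h4, hF.mean_eq _ h₀ j]
  have h6 : t • v = 0 := by simpa using h5
  rcases smul_eq_zero.1 h6 with h | h
  · exact ht0.ne' h
  · exact hv h

lemma exp_moment (hF : IsMeanValueExpFam ν M p θ φ ψ carrier) {μ₀ : Fin m → ℝ} (h₀ : μ₀ ∈ M) :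
    ∃ δ > 0, ∃ F : 𝒳 → ℝ, Integrable F ν ∧ ∀ x, Real.exp (δ * ‖φ x‖) * p μ₀ x ≤ F x := by
  have key : ∃ δ > 0, ∃ F : 𝒳 → ℝ, Integrable F ν ∧ (∀ x, 0 ≤ F x) ∧
      ∀ x, ∀ v ∈ Metric.sphere (0 : Fin m → ℝ) 1, ∀ t ≥ 0, φ x = t • v →
        Real.exp (δ * t) * p μ₀ x ≤ F x := by
    refine IsCompact.induction_on (isCompact_sphere (0 : Fin m → ℝ) 1)
      (p := fun s => ∃ δ > 0, ∃ F : 𝒳 → ℝ, Integrable F ν ∧ (∀ x, 0 ≤ F x) ∧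
      ∀ x, ∀ v ∈ s, ∀ t ≥ 0, φ x = t • v →
        Real.exp (δ * t) * p μ₀ x ≤ F x) ?_ ?_ ?_ ?_
    · exact ⟨1, one_pos, 0, integrable_zero _ _ _, fun _ => le_rfl, fun x v hv => hv.elim⟩
    · rintro s t hst ⟨δ, hδ, F, hF1, hF2, hF3⟩
      exact ⟨δ, hδ, F, hF1, hF2, fun x v hv => hF3 x v (hst hv)⟩
    · rintro s t ⟨δ, hδ, F, hF1, hF2, hF3⟩ ⟨δ', hδ', G, hG1, hG2, hG3⟩
      refine ⟨min δ δ', lt_min hδ hδ', fun x => F x + G x, hF1.add hG1,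
        fun x => add_nonneg (hF2 x) (hG2 x), fun x v hv r hr hx => ?_⟩
      have pp := (p_pos hF h₀ x).le
      rcases hv with hv | hv
      · have h1 : Real.exp (min δ δ' * r) ≤ Real.exp (δ * r) :=
          Real.exp_le_exp.2 (mul_le_mul_of_nonneg_right (min_le_left _ _) hr)
        have := mul_le_mul_of_nonneg_right h1 pp
        linarith [hF3 x v hv r hr hx, hG2 x]
      · have h1 : Real.exp (min δ δ' * r) ≤ Real.exp (δ' * r) :=
          Real.exp_le_exp.2 (mul_le_mul_of_nonneg_right (min_le_right _ _) hr)
        have := mul_le_mul_of_nonneg_right h1 pp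
        linarith [hG3 x v hv r hr hx, hF2 x]
    · intro v hv
      have hv0 : v ≠ 0 := by rintro rfl; simp at hv
      obtain ⟨μ, hμ, hd⟩ := dir_pos hF h₀ v hv0
      set d := dot v (θ μ - θ μ₀) with hdd
      have hcont : Continuous fun u : Fin m → ℝ => dot u (θ μ - θ μ₀) := by
        unfold dot; fun_prop
      refine ⟨{u | d / 2 < dot u (θ μ - θ μ₀)}, mem_nhdsWithin_of_mem_nhds
        ((isOpen_lt continuous_const hcont).mem_nhds (by simp only [mem_setOf_eq]; linarith)),
        d / 2, by linarith, fun x => Real.exp (ψ (θ μ) - ψ (θ μ₀)) * p μ x,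
        (p_int hF hμ).const_mul _, fun x => mul_nonneg (Real.exp_pos _).le (p_pos hF hμ x).le, ?_⟩
      intro x u hu t ht hx
      have hu' : d / 2 < dot u (θ μ - θ μ₀) := hu
      beta_reduce
      rw [p_eq hF h₀, p_eq hF hμ, ← mul_assoc, ← mul_assoc, ← Real.exp_add, ← Real.exp_add]
      refine mul_le_mul_of_nonneg_right (Real.exp_le_exp.2 ?_) (hF.carrier_pos x).le
      have e : dot (θ μ) (φ x) - dot (θ μ₀) (φ x) = t * dot u (θ μ - θ μ₀) := by
        rw [hx]
        simp only [dot, Pi.smul_apply, smul_eq_mul, Finset.mul_sum, ← Finset.sum_sub_distrib,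
          Pi.sub_apply]
        exact Finset.sum_congr rfl fun j _ => by ring
      have := mul_le_mul_of_nonneg_left hu'.le ht
      simp only [lw]; linarith
  obtain ⟨δ, hδ, F, hF1, hF2, hF3⟩ := key
  refine ⟨δ, hδ, fun x => F x + p μ₀ x, hF1.add (p_int hF h₀), fun x => ?_⟩
  have pp := p_pos hF h₀ x
  by_cases hx : φ x = 0
  · rw [hx]; simp only [norm_zero, mul_zero, Real.exp_zero]; linarith [hF2 x]
  · have hn : 0 < ‖φ x‖ := norm_pos_iff.2 hx
    have := hF3 x (‖φ x‖⁻¹ • φ x) (by simp [norm_smul, hn.ne']) ‖φ x‖ hn.le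
      (by simp [smul_smul, hn.ne'])
    linarith

lemma sum_abs_le (a : Fin m → ℝ) : ∑ j, |a j| ≤ m * ‖a‖ := by
  have : ∑ j, |a j| ≤ ∑ _j : Fin m, ‖a‖ := Finset.sum_le_sum fun j _ => norm_le_pi_norm a j
  simpa using this

lemma second_moment (hF : IsMeanValueExpFam ν M p θ φ ψ carrier) {μ₀ : Fin m → ℝ} (h₀ : μ₀ ∈ M) :
    ∃ ε > 0, ∃ H : 𝒳 → ℝ, Integrable H ν ∧ ∀ μ ∈ Metric.ball μ₀ ε, ∀ x,
      (1 + sz φ x) ^ 2 * p μ x ≤ H x := by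
  obtain ⟨ε, hε, K, hK, hL⟩ := exists_loc hF h₀
  have h00 : μ₀ ∈ Metric.ball μ₀ ε := Metric.mem_ball_self hε
  obtain ⟨c, hc, hcc⟩ := exists_c hF hL h00
  obtain ⟨δ, hδ, F, hF1, hF3⟩ := exp_moment hF h₀
  set η : ℝ := δ / (2 * (m + 1)) with hη
  have hη0 : 0 < η := by positivity
  have hηm : η * m ≤ δ / 2 := by
    rw [hη, div_mul_eq_mul_div, div_le_div_iff₀ (by positivity) two_pos]
    nlinarith
  set ρ : ℝ := c * η ^ 2 / (2 * K * (m + 1)) with hρ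
  have hρ0 : 0 < ρ := by positivity
  set C : ℝ := 2 + 4 * m ^ 2 / (δ/2) ^ 2 with hC
  have hC0 : 0 < C := by positivity
  refine ⟨min ε ρ, lt_min hε hρ0, fun x => C * Real.exp (2 * K) * F x, hF1.const_mul _, ?_⟩
  intro μ hμ x
  have hμε : μ ∈ Metric.ball μ₀ ε := Metric.ball_subset_ball (min_le_left _ _) hμ
  have hμρ : ‖μ - μ₀‖ < ρ := by
    rw [← dist_eq_norm]; exact Metric.ball_subset_ball (min_le_right _ _) hμ
  have hM := (hL _ hμε).1
  have hθ : ∀ j, |(θ μ - θ μ₀) j| ≤ η := by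
    intro j
    have h1 := strong_mono hF hL hcc hμε h00
    have h2 : |dot (θ μ - θ μ₀) (μ - μ₀)| ≤ (2 * K) * ∑ j, |(μ - μ₀) j| :=
      dot_abs_le _ (fun j => by
        have a1 := (hL _ hμε).2.1 j
        have a2 := (hL _ h00).2.1 j
        have a3 := abs_sub (θ μ j) (θ μ₀ j)
        simp only [Pi.sub_apply]; linarith) _
    have h3 := sum_abs_le (μ - μ₀)
    have h4 : (m : ℝ) * ‖μ - μ₀‖ ≤ (m + 1) * ρ := by
      have : (0:ℝ) ≤ m := Nat.cast_nonneg m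
      nlinarith [norm_nonneg (μ - μ₀)]
    have h5 : (2 * K) * ((m + 1) * ρ) = c * η ^ 2 := by rw [hρ]; field_simp
    have h6 := mul_le_mul_of_nonneg_left (h3.trans h4) (by linarith : 0 ≤ 2 * K)
    have h7 : (θ μ j - θ μ₀ j) ^ 2 ≤ ∑ j, (θ μ j - θ μ₀ j) ^ 2 :=
      Finset.single_le_sum (f := fun j => (θ μ j - θ μ₀ j) ^ 2) (fun _ _ => sq_nonneg _)
        (Finset.mem_univ j)
    have h8 := mul_le_mul_of_nonneg_left h7 hc.le
    have h9 : c * (θ μ j - θ μ₀ j) ^ 2 ≤ c * η ^ 2 := by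
      linarith [le_abs_self (dot (θ μ - θ μ₀) (μ - μ₀))]
    exact abs_le_of_sq_le_sq (le_of_mul_le_mul_left h9 hc) hη0.le
  have hN := norm_nonneg (φ x)
  set N := ‖φ x‖ with hNN
  have hsz : sz φ x ≤ m * N := sum_abs_le (φ x)
  have hsz0 := sz_nonneg (φ := φ) x
  have hlw : lw θ φ ψ μ x ≤ δ / 2 * N + 2 * K + lw θ φ ψ μ₀ x := by
    have e : lw θ φ ψ μ x - lw θ φ ψ μ₀ x = dot (θ μ - θ μ₀) (φ x) - (ψ (θ μ) - ψ (θ μ₀)) := by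
      simp only [lw, dot, Pi.sub_apply, sub_mul, Finset.sum_sub_distrib]; ring
    have a1 := (le_abs_self _).trans (dot_abs_le _ hθ (φ x))
    have a2 := mul_le_mul_of_nonneg_left (sum_abs_le (φ x)) hη0.le
    have a3 := mul_le_mul_of_nonneg_right hηm hN
    have a4 := abs_le.1 (hL _ hμε).2.2
    have a5 := abs_le.1 (hL _ h00).2.2
    rw [← hNN] at a2
    linarith [a4.1, a5.2]
  have hp : p μ x ≤ Real.exp (δ / 2 * N) * Real.exp (2 * K) * p μ₀ x := by
    rw [p_eq hF hM, p_eq hF h₀, ← mul_assoc, ← Real.exp_add, ← Real.exp_add]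
    exact mul_le_mul_of_nonneg_right (Real.exp_le_exp.2 hlw) (hF.carrier_pos x).le
  have hq : (1 + sz φ x) ^ 2 ≤ C * Real.exp (δ / 2 * N) := by
    have b1 := Real.quadratic_le_exp_of_nonneg (by positivity : 0 ≤ δ / 2 * N)
    have b2 : (1 + sz φ x) ^ 2 ≤ (1 + m * N) ^ 2 := by
      apply pow_le_pow_left₀ <;> linarith
    have b3 : (1 + m * N) ^ 2 ≤ 2 + 2 * (m * N) ^ 2 := by nlinarith [sq_nonneg (1 - m * N)]
    have b4 : C * (1 + δ / 2 * N + (δ / 2 * N) ^ 2 / 2) ≤ C * Real.exp (δ / 2 * N) :=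
      mul_le_mul_of_nonneg_left b1 hC0.le
    have b5 : 2 + 2 * (m * N) ^ 2 ≤ C * (1 + δ / 2 * N + (δ / 2 * N) ^ 2 / 2) := by
      have c1 : C * (1 + δ / 2 * N + (δ / 2 * N) ^ 2 / 2) = 2 * (1 + δ / 2 * N + (δ / 2 * N) ^ 2 / 2)
        + 4 * m ^ 2 / (δ/2) ^ 2 * (1 + δ / 2 * N) + 2 * (m * N) ^ 2 := by
        rw [hC]; field_simp; ring
      rw [c1]
      have c2 : 0 ≤ 4 * (m:ℝ) ^ 2 / (δ/2) ^ 2 * (1 + δ / 2 * N) := by positivity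
      have c3 : 0 ≤ δ / 2 * N := by positivity
      nlinarith [sq_nonneg (δ / 2 * N)]
    linarith
  have pp := p_pos hF hM x
  have pp0 := p_pos hF h₀ x
  calc (1 + sz φ x) ^ 2 * p μ x
      ≤ (C * Real.exp (δ / 2 * N)) * (Real.exp (δ / 2 * N) * Real.exp (2 * K) * p μ₀ x) :=
        mul_le_mul hq hp pp.le (by positivity)
    _ = C * Real.exp (2 * K) * (Real.exp (δ * N) * p μ₀ x) := by
        have : Real.exp (δ * N) = Real.exp (δ / 2 * N) * Real.exp (δ / 2 * N) := by
          rw [← Real.exp_add]; congr 1; ring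
        rw [this]; ring
    _ ≤ C * Real.exp (2 * K) * F x := mul_le_mul_of_nonneg_left (hF3 x) (by positivity)


lemma cov_bounds (hF : IsMeanValueExpFam ν M p θ φ ψ carrier) {U : Set (Fin m → ℝ)} {K : ℝ}
    (hL : Loc M θ ψ U K) {c : ℝ} (hc : ∀ (v : Fin m → ℝ) (s : ℝ),
      Integrable (fun x => (dot v (φ x) - s) ^ 2 * gw φ carrier K x) ν ∧
      c * ∑ j, v j ^ 2 ≤ ∫ x, (dot v (φ x) - s) ^ 2 * gw φ carrier K x ∂ν)
    {H : 𝒳 → ℝ} (hH : Integrable H ν) {B : ℝ} (hB : 1 ≤ B)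
    {μ : Fin m → ℝ} (h : μ ∈ U) (hμB : ‖μ‖ ≤ B)
    (hb : ∀ x, (1 + sz φ x) ^ 2 * p μ x ≤ H x) (v : Fin m → ℝ) :
    c * ∑ j, v j ^ 2 ≤ quadForm (covMatrix ν p φ μ) v ∧
    quadForm (covMatrix ν p φ μ) v ≤ (m * B ^ 2 * ∫ x, H x ∂ν) * ∑ j, v j ^ 2 := by
  have hM := (hL _ h).1
  have hbd : ∀ x j, |φ x j - μ j| ≤ B * (1 + sz φ x) := by
    intro x j
    have h1 := abs_sub (φ x j) (μ j)
    have h2 := le_sz (φ := φ) x j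
    have h3 : |μ j| ≤ ‖μ‖ := norm_le_pi_norm μ j
    nlinarith [sz_nonneg (φ := φ) x]
  have hi : ∀ i j, Integrable (fun x => (φ x i - μ i) * (φ x j - μ j) * p μ x) ν := by
    intro i j
    have hm : ∀ j, Measurable fun x => φ x j := fun j => (measurable_pi_apply j).comp hF.φ_meas
    refine (hH.const_mul (B ^ 2)).mono' ?_ ?_
    · exact ((((hm i).sub_const _).mul ((hm j).sub_const _)).mul (hF.p_meas μ)).aestronglyMeasurable
    · refine Filter.Eventually.of_forall fun x => ?_
      have pp := p_pos hF hM x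
      have hs := sz_nonneg (φ := φ) x
      rw [Real.norm_eq_abs, abs_mul, abs_mul, abs_of_pos pp]
      have h1 : |φ x i - μ i| * |φ x j - μ j| ≤ (B * (1 + sz φ x)) * (B * (1 + sz φ x)) :=
        mul_le_mul (hbd x i) (hbd x j) (abs_nonneg _) (by positivity)
      have h2 := mul_le_mul_of_nonneg_right h1 pp.le
      have h3 := mul_le_mul_of_nonneg_left (hb x) (sq_nonneg B)
      linarith
  have hq := quad_integral (ν := ν) (fun x => φ x - μ) (p μ) hi v
  have e : quadForm (covMatrix ν p φ μ) v = ∫ x, (dot v (φ x - μ)) ^ 2 * p μ x ∂ν := hq.2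
  rw [e]
  constructor
  · refine (hc v (dot v μ)).2.trans (integral_mono (hc v (dot v μ)).1 hq.1 fun x => ?_)
    have e2 : dot v (φ x - μ) = dot v (φ x) - dot v μ := by
      simp only [dot, Pi.sub_apply, mul_sub, Finset.sum_sub_distrib]
    simp only [e2]
    exact mul_le_mul_of_nonneg_left (gw_le hF hL h x) (sq_nonneg _)
  · have e3 : (m * B ^ 2 * ∫ x, H x ∂ν) * ∑ j, v j ^ 2
        = ∫ x, (m * B ^ 2 * ∑ j, v j ^ 2) * H x ∂ν := by
      rw [integral_const_mul]; ring
    rw [e3]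
    refine integral_mono hq.1 (hH.const_mul _) fun x => ?_
    have pp := p_pos hF hM x
    have hs := sz_nonneg (φ := φ) x
    have h1 : (dot v (φ x - μ)) ^ 2 ≤ (∑ j, v j ^ 2) * ∑ j, (φ x - μ) j ^ 2 :=
      Finset.sum_mul_sq_le_sq_mul_sq _ _ _
    have h2 : ∑ j, (φ x - μ) j ^ 2 ≤ m * (B * (1 + sz φ x)) ^ 2 := by
      have : ∑ j, (φ x - μ) j ^ 2 ≤ ∑ _j : Fin m, (B * (1 + sz φ x)) ^ 2 :=
        Finset.sum_le_sum fun j _ => by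
          rw [← sq_abs]
          exact pow_le_pow_left₀ (abs_nonneg _) (hbd x j) 2
      simpa using this
    have hv0 : 0 ≤ ∑ j, v j ^ 2 := Finset.sum_nonneg fun _ _ => sq_nonneg _
    have h3 := h1.trans (mul_le_mul_of_nonneg_left h2 hv0)
    have h4 := mul_le_mul_of_nonneg_right h3 pp.le
    have h5 := mul_le_mul_of_nonneg_left (hb x)
      (by positivity : 0 ≤ (m * B ^ 2 * ∑ j, v j ^ 2))
    have h6 : (∑ j, v j ^ 2) * (m * (B * (1 + sz φ x)) ^ 2) * p μ x
      = (m * B ^ 2 * ∑ j, v j ^ 2) * ((1 + sz φ x) ^ 2 * p μ x) := by ring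
    beta_reduce
    linarith

lemma dist_sq_le (a b : Fin m → ℝ) : ‖a - b‖ ^ 2 ≤ sqDist a b := by
  have h0 : 0 ≤ sqDist a b := Finset.sum_nonneg fun _ _ => sq_nonneg _
  have : ‖a - b‖ ≤ Real.sqrt (sqDist a b) := by
    refine (pi_norm_le_iff_of_nonneg (Real.sqrt_nonneg _)).2 fun j => ?_
    refine Real.le_sqrt_of_sq_le ?_
    rw [Real.norm_eq_abs, sq_abs]
    exact Finset.single_le_sum (f := fun j => (a j - b j) ^ 2) (fun _ _ => sq_nonneg _)
        (Finset.mem_univ j)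
  calc ‖a - b‖ ^ 2 ≤ Real.sqrt (sqDist a b) ^ 2 := pow_le_pow_left₀ (norm_nonneg _) this 2
    _ = _ := Real.sq_sqrt h0

/-- bounds on a set -/
def Bd (ν : Measure 𝒳) (M : Set (Fin m → ℝ)) (p : (Fin m → ℝ) → 𝒳 → ℝ)
    (φ : 𝒳 → (Fin m → ℝ)) (s : Set (Fin m → ℝ)) : Prop :=
  ∃ a > (0:ℝ), ∃ b > (0:ℝ), ∀ μ' ∈ s, ∀ μ ∈ M,
    dH2 ν (p μ') (p μ) ≤ b * sqDist μ' μ ∧ a * sqDist μ' μ ≤ dST ν p φ μ' μ ∧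
    dST ν p φ μ' μ ≤ b * sqDist μ' μ

lemma local_bd (hF : IsMeanValueExpFam ν M p θ φ ψ carrier) {μ₀ : Fin m → ℝ} (h₀ : μ₀ ∈ M) :
    ∃ ε > 0, Bd ν M p φ (Metric.ball μ₀ ε) := by
  obtain ⟨ε, hε, K, hK, hL⟩ := exists_loc hF h₀
  have h00 : μ₀ ∈ Metric.ball μ₀ ε := Metric.mem_ball_self hε
  obtain ⟨c, hc, hcc⟩ := exists_c hF hL h00
  obtain ⟨ε', hε', H, hH, hHb⟩ := second_moment hF h₀
  set r := min (ε/2) ε' with hr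
  have hr0 : 0 < r := lt_min (by linarith) hε'
  set B := 1 + ‖μ₀‖ + r with hB
  set b₁ := m * B ^ 2 * (∫ x, H x ∂ν) with hb₁
  have hH0 : 0 ≤ ∫ x, H x ∂ν := integral_nonneg fun x => by
    have pp := p_pos hF h₀ x
    exact le_trans (by positivity) (hHb μ₀ (Metric.mem_ball_self hε') x)
  have hb1 : 0 ≤ b₁ := by positivity
  refine ⟨r, hr0, 1 / (b₁ + 1), by positivity, 1 / c + 2 / (ε/2) ^ 2, by positivity, ?_⟩
  intro μ' hμ' μ hμ
  have hμε : μ' ∈ Metric.ball μ₀ ε := Metric.ball_subset_ball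
    ((min_le_left _ _).trans (by linarith)) hμ'
  have hM' := (hL _ hμε).1
  have hsq : 0 ≤ sqDist μ' μ := Finset.sum_nonneg fun _ _ => sq_nonneg _
  have hB1 : ‖μ'‖ ≤ B := by
    have h1 : ‖μ' - μ₀‖ < r := by rw [← dist_eq_norm]; exact hμ'
    have h2 := norm_sub_norm_le μ' μ₀
    linarith
  have hcov := cov_bounds hF hL hcc hH (by linarith [norm_nonneg μ₀] : 1 ≤ B) hμε hB1
    (hHb μ' (Metric.ball_subset_ball (min_le_right _ _) hμ'))
  have hsym : (covMatrix ν p φ μ').transpose = covMatrix ν p φ μ' := by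
    ext i j
    simp only [Matrix.transpose_apply, covMatrix, Matrix.of_apply]
    congr 1; funext x; ring
  have hinv := inv_bounds _ hsym hc (by linarith : 0 < b₁ + 1) (fun v => (hcov v).1)
    (fun v => (hcov v).2.trans (by
      have : 0 ≤ ∑ j, v j ^ 2 := Finset.sum_nonneg fun _ _ => sq_nonneg _
      nlinarith)) (μ - μ')
  have es : ∑ j, (μ - μ') j ^ 2 = sqDist μ' μ := by
    unfold sqDist
    exact Finset.sum_congr rfl fun j _ => by rw [Pi.sub_apply]; ring
  rw [es] at hinv
  have hpos2 : 0 ≤ 2 / (ε/2) ^ 2 * sqDist μ' μ := by positivity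
  have hpos1 : 0 ≤ 1 / c * sqDist μ' μ := by positivity
  refine ⟨?_, hinv.1, ?_⟩
  · have hh := hell hF hM' hμ
    rw [add_mul]
    by_cases hd : ‖μ' - μ‖ < ε / 2
    · have hμ2 : μ ∈ Metric.ball μ₀ ε := by
        rw [Metric.mem_ball]
        have h1 : dist μ' μ₀ < ε / 2 := lt_of_lt_of_le hμ' (min_le_left _ _)
        have h2 := dist_triangle_left μ μ₀ μ'
        rw [dist_eq_norm μ' μ] at h2
        linarith
      have h1 := strong_mono hF hL hcc hμε hμ2
      have h2 : dot (θ μ' - θ μ) (μ' - μ) ≤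
          c / 2 * ∑ j, (θ μ' j - θ μ j) ^ 2 + 1 / (2 * c) * sqDist μ' μ := by
        simp only [dot, sqDist, Finset.mul_sum, ← Finset.sum_add_distrib, Pi.sub_apply]
        refine Finset.sum_le_sum fun j _ => ?_
        have h3 : c / 2 * (θ μ' j - θ μ j) ^ 2 + 1 / (2 * c) * (μ' j - μ j) ^ 2
          - (θ μ' j - θ μ j) * (μ' j - μ j)
            = 1 / (2 * c) * (c * (θ μ' j - θ μ j) - (μ' j - μ j)) ^ 2 := by
          field_simp; ring
        have h4 : 0 ≤ 1 / (2 * c) * (c * (θ μ' j - θ μ j) - (μ' j - μ j)) ^ 2 := by positivity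
        linarith
      have h5 : 1 / (2 * c) * sqDist μ' μ = 1 / c * sqDist μ' μ / 2 := by field_simp
      linarith [hh.1]
    · push Not at hd
      have h1 := dist_sq_le μ' μ
      have h2 : (ε/2) ^ 2 ≤ ‖μ' - μ‖ ^ 2 := pow_le_pow_left₀ (by linarith) hd 2
      have h3 : 2 ≤ 2 / (ε/2) ^ 2 * sqDist μ' μ := by
        rw [div_mul_eq_mul_div, le_div_iff₀ (by positivity)]; linarith
      linarith [hh.2]
  · rw [add_mul]
    exact hinv.2.trans (by linarith)

lemma compact_bd (hF : IsMeanValueExpFam ν M p θ φ ψ carrier) {M' : Set (Fin m → ℝ)}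
    (hc : IsCompact M') (hs : M' ⊆ M) : Bd ν M p φ M' := by
  refine hc.induction_on (p := fun s => Bd ν M p φ s) ?_ ?_ ?_ ?_
  · exact ⟨1, one_pos, 1, one_pos, fun _ h => h.elim⟩
  · rintro s t hst ⟨a, ha, b, hb, h⟩
    exact ⟨a, ha, b, hb, fun μ' hμ' => h μ' (hst hμ')⟩
  · rintro s t ⟨a, ha, b, hb, h⟩ ⟨a', ha', b', hb', h'⟩
    refine ⟨min a a', lt_min ha ha', max b b', lt_max_of_lt_left hb, fun μ' hμ' μ hμ => ?_⟩
    have hsq : 0 ≤ sqDist μ' μ := Finset.sum_nonneg fun _ _ => sq_nonneg _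
    have m1 := mul_le_mul_of_nonneg_right (min_le_left a a') hsq
    have m2 := mul_le_mul_of_nonneg_right (min_le_right a a') hsq
    have m3 := mul_le_mul_of_nonneg_right (le_max_left b b') hsq
    have m4 := mul_le_mul_of_nonneg_right (le_max_right b b') hsq
    rcases hμ' with hμ' | hμ'
    · obtain ⟨k1, k2, k3⟩ := h μ' hμ' μ hμ
      exact ⟨by linarith, by linarith, by linarith⟩
    · obtain ⟨k1, k2, k3⟩ := h' μ' hμ' μ hμ
      exact ⟨by linarith, by linarith, by linarith⟩
  · intro μ hμ
    obtain ⟨ε, hε, h⟩ := local_bd hF (hs hμ)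
    exact ⟨_, mem_nhdsWithin_of_mem_nhds (Metric.ball_mem_nhds μ hε), h⟩

end aux
end SwitchPaper

namespace SwitchPaper

/-- Proposition 1, second part: for `μ'` in a CINECSI subset `M'` of the
mean-value parameter space `M` and `μ` ranging over all of `M`,
`d_{H²}(μ',μ) ≤ c₁'‖μ'−μ‖₂² ≤ c₂'·d_ST(μ'‖μ) ≤ c₃'‖μ'−μ‖₂²`. -/
theorem statement_1 {𝒳 : Type*} [MeasurableSpace 𝒳] {m : ℕ} (ν : Measure 𝒳)
    (M M' : Set (Fin m → ℝ)) (p : (Fin m → ℝ) → 𝒳 → ℝ)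
    (θ : (Fin m → ℝ) → (Fin m → ℝ)) (φ : 𝒳 → (Fin m → ℝ)) (ψ : (Fin m → ℝ) → ℝ)
    (carrier : 𝒳 → ℝ)
    (hF : IsMeanValueExpFam ν M p θ φ ψ carrier)
    (hM' : CINECSI M' M) :
    ∃ c₁' > (0:ℝ), ∃ c₂' > (0:ℝ), ∃ c₃' > (0:ℝ), ∀ μ' ∈ M', ∀ μ ∈ M,
      dH2 ν (p μ') (p μ) ≤ c₁' * sqDist μ' μ ∧
      c₁' * sqDist μ' μ ≤ c₂' * dST ν p φ μ' μ ∧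
      c₂' * dST ν p φ μ' μ ≤ c₃' * sqDist μ' μ := by
  obtain ⟨a, ha, b, hb, h⟩ := compact_bd hF hM'.2.2.1 (hM'.2.1.trans interior_subset)
  refine ⟨b, hb, b / a, by positivity, b / a * b, by positivity, fun μ' hμ' μ hμ => ?_⟩
  obtain ⟨k1, k2, k3⟩ := h μ' hμ' μ hμ
  have hba : 0 < b / a := by positivity
  refine ⟨k1, ?_, ?_⟩
  · have := mul_le_mul_of_nonneg_left k2 hba.le
    rwa [← mul_assoc, div_mul_cancel₀ _ ha.ne'] at this
  · rw [mul_assoc]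
    exact mul_le_mul_of_nonneg_left k3 hba.le

end SwitchPaper
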